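/- arXiv:2006.08958 — 4 statements merged into one kernel-verified Lean document; each statement's English description precedes it below -/
import Mathlib

section
/- Let 𝒯' be a finite set of tasks, 𝒩 ⊆ 𝒯' × 𝒯' a set of negator relationships, and A ∈ 𝒯'. Form the extended instance by adding three new tasks X, Y, Z ∉ 𝒯', with task set 𝒯 = 𝒯' ∪ {X, Y, Z} and negator relationships 𝒩' = 𝒩 ∪ {(A, X), (A, Y), (A, Z), (X, Z), (Z, Y), (Y, X)}. Then there exists a stable task assignment V ⊆ 𝒯 for (𝒯, 𝒩') if and only if there exists a stable task assignment V' ⊆ 𝒯' for (𝒯', 𝒩) with A ∈ V'. (This is the correctness of the polynomial-time reduction from NEGATOR-SAT to NEGATOR-STABILITY.) -/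
/-- A stable task assignment: `V ⊆ 𝒯`, every non-assigned task of `𝒯` has an inbound
negator relationship from an assigned task, and no assigned task has an inbound
negator relationship from an assigned task. -/
def IsStable {α : Type*} (𝒯 : Finset α) (𝒩 : Finset (α × α)) (V : Finset α) : Prop :=
  V ⊆ 𝒯 ∧ (∀ t ∈ 𝒯, t ∉ V → ∃ t' ∈ V, (t', t) ∈ 𝒩) ∧ ∀ t ∈ V, ∀ t' ∈ V, (t', t) ∉ 𝒩

/-- Correctness of the reduction from NEGATOR-SAT to NEGATOR-STABILITY:
the extended instance (three fresh tasks `X, Y, Z` with negators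
`(A,X), (A,Y), (A,Z), (X,Z), (Z,Y), (Y,X)` added) admits a stable task assignment
iff the original instance admits a stable task assignment containing `A`. -/
theorem negSat_to_negStab {α : Type*} [DecidableEq α] (𝒯' : Finset α)
    (𝒩 : Finset (α × α)) (h𝒩 : 𝒩 ⊆ 𝒯' ×ˢ 𝒯') (A : α) (hA : A ∈ 𝒯')
    (X Y Z : α) (hX : X ∉ 𝒯') (hY : Y ∉ 𝒯') (hZ : Z ∉ 𝒯')
    (hXY : X ≠ Y) (hXZ : X ≠ Z) (hYZ : Y ≠ Z) :
    (∃ V : Finset α, IsStable (𝒯' ∪ {X, Y, Z})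
        (𝒩 ∪ {(A, X), (A, Y), (A, Z), (X, Z), (Z, Y), (Y, X)}) V) ↔
    (∃ V' : Finset α, IsStable 𝒯' 𝒩 V' ∧ A ∈ V') := by
  have key : ∀ a b, (a, b) ∈ 𝒩 → a ∈ 𝒯' ∧ b ∈ 𝒯' := fun a b h => by
    simpa using h𝒩 h
  have hAX : A ≠ X := fun h => hX (h ▸ hA)
  have hAY : A ≠ Y := fun h => hY (h ▸ hA)
  have hAZ : A ≠ Z := fun h => hZ (h ▸ hA)
  have mem : ∀ a b, (a, b) ∈ 𝒩 ∪ {(A, X), (A, Y), (A, Z), (X, Z), (Z, Y), (Y, X)} ↔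
      (a, b) ∈ 𝒩 ∨ (a = A ∧ b = X) ∨ (a = A ∧ b = Y) ∨ (a = A ∧ b = Z) ∨ (a = X ∧ b = Z) ∨
        (a = Z ∧ b = Y) ∨ (a = Y ∧ b = X) := by
    intro a b
    simp only [Finset.mem_union, Finset.mem_insert, Finset.mem_singleton, Prod.mk.injEq]
  constructor
  · rintro ⟨V, hV, h1, h2⟩
    simp only [mem] at h1 h2
    have eX : X ∉ V → A ∈ V ∨ Y ∈ V := by
      intro h
      obtain ⟨t, ht, hn⟩ := h1 X (by simp) h
      grind
    have eY : Y ∉ V → A ∈ V ∨ Z ∈ V := by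
      intro h
      obtain ⟨t, ht, hn⟩ := h1 Y (by simp) h
      grind
    have eZ : Z ∉ V → A ∈ V ∨ X ∈ V := by
      intro h
      obtain ⟨t, ht, hn⟩ := h1 Z (by simp) h
      grind
    have dXZ : X ∈ V → Z ∉ V := fun h h' => h2 Z h' X h (by simp)
    have dZY : Z ∈ V → Y ∉ V := fun h h' => h2 Y h' Z h (by simp)
    have dYX : Y ∈ V → X ∉ V := fun h h' => h2 X h' Y h (by simp)
    have hAV : A ∈ V := by tauto
    have nX : X ∉ V := fun h' => h2 X h' A hAV (by simp)
    have nY : Y ∉ V := fun h' => h2 Y h' A hAV (by simp)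
    have nZ : Z ∉ V := fun h' => h2 Z h' A hAV (by simp)
    refine ⟨V, ⟨?_, ?_, ?_⟩, hAV⟩
    · intro t ht
      have := hV ht
      simp only [Finset.mem_union, Finset.mem_insert, Finset.mem_singleton] at this
      grind
    · intro t ht htV
      obtain ⟨t', ht', hn⟩ := h1 t (by simp [ht]) htV
      refine ⟨t', ht', ?_⟩
      grind
    · intro t ht t' ht' hn
      exact h2 t ht t' ht' (Or.inl hn)
  · rintro ⟨V, ⟨hV, h1, h2⟩, hAV⟩
    refine ⟨V, hV.trans Finset.subset_union_left, ?_, ?_⟩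
    · intro t ht htV
      simp only [mem]
      simp only [Finset.mem_union, Finset.mem_insert, Finset.mem_singleton] at ht
      rcases ht with ht | ht
      · obtain ⟨t', ht', hn⟩ := h1 t ht htV
        exact ⟨t', ht', Or.inl hn⟩
      · exact ⟨A, hAV, by tauto⟩
    · intro t ht t' ht'
      rw [mem]
      have a := hV ht
      have b := h2 t ht t' ht'
      grind
end

section
/- Let 𝒯' be a finite set of tasks, 𝒩 ⊆ 𝒯' × 𝒯' negator relationships, A ∈ 𝒯', and let 𝒯 = 𝒯' ∪ {X, Y, Z} with new tasks X, Y, Z ∉ 𝒯' and 𝒩' = 𝒩 ∪ {(A, X), (A, Y), (A, Z), (X, Z), (Z, Y), (Y, X)}. Then every stable task assignment V ⊆ 𝒯 for (𝒯, 𝒩') satisfies A ∈ V and X ∉ V, Y ∉ V, Z ∉ V; moreover V ∩ 𝒯' is a stable task assignment for (𝒯', 𝒩). -/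
/-- In the extended NEGATOR-STABILITY instance, every stable task assignment contains
`A`, contains none of `X, Y, Z`, and restricts to a stable task assignment of the
original instance. -/
theorem stable_extended_forces_A {α : Type*} [DecidableEq α] (𝒯' : Finset α)
    (𝒩 : Finset (α × α)) (h𝒩 : 𝒩 ⊆ 𝒯' ×ˢ 𝒯') (A : α) (hA : A ∈ 𝒯')
    (X Y Z : α) (hX : X ∉ 𝒯') (hY : Y ∉ 𝒯') (hZ : Z ∉ 𝒯')
    (hXY : X ≠ Y) (hXZ : X ≠ Z) (hYZ : Y ≠ Z) (V : Finset α)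
    (hV : IsStable (𝒯' ∪ {X, Y, Z})
      (𝒩 ∪ {(A, X), (A, Y), (A, Z), (X, Z), (Z, Y), (Y, X)}) V) :
    A ∈ V ∧ X ∉ V ∧ Y ∉ V ∧ Z ∉ V ∧ IsStable 𝒯' 𝒩 (V ∩ 𝒯') := by
  obtain ⟨hsub, hout, hin⟩ := hV
  have hN : ∀ a b, (a, b) ∈ 𝒩 → a ∈ 𝒯' ∧ b ∈ 𝒯' := fun a b h => by
    simpa using h𝒩 h
  simp only [Finset.mem_union, Finset.mem_insert, Finset.mem_singleton, Prod.mk.injEq] at hout hin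
  have oX : X ∉ V → A ∈ V ∨ Y ∈ V := fun h => by
    obtain ⟨t, ht, h'⟩ := hout X (by simp) h
    have := hN t X
    grind
  have oY : Y ∉ V → A ∈ V ∨ Z ∈ V := fun h => by
    obtain ⟨t, ht, h'⟩ := hout Y (by simp) h
    have := hN t Y
    grind
  have oZ : Z ∉ V → A ∈ V ∨ X ∈ V := fun h => by
    obtain ⟨t, ht, h'⟩ := hout Z (by simp) h
    have := hN t Z
    grind
  have iXZ : X ∈ V → Z ∉ V := fun h1 h2 => hin Z h2 X h1 (by simp)
  have iZY : Z ∈ V → Y ∉ V := fun h1 h2 => hin Y h2 Z h1 (by simp)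
  have iYX : Y ∈ V → X ∉ V := fun h1 h2 => hin X h2 Y h1 (by simp)
  have hAV : A ∈ V := by tauto
  refine ⟨hAV, fun h => hin X h A hAV (by simp), fun h => hin Y h A hAV (by simp),
    fun h => hin Z h A hAV (by simp), Finset.inter_subset_right, ?_, ?_⟩
  · intro t ht htV
    obtain ⟨t', ht', h'⟩ := hout t (Or.inl ht) (fun h => htV (Finset.mem_inter.2 ⟨h, ht⟩))
    have h2 : (t', t) ∈ 𝒩 := by
      rcases h' with h' | h'
      · exact h'
      · grind
    exact ⟨t', Finset.mem_inter.2 ⟨ht', (hN _ _ h2).1⟩, h2⟩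
  · intro t ht t' ht' h
    exact hin t (Finset.mem_inter.1 ht).1 t' (Finset.mem_inter.1 ht').1 (Or.inl h)
end

section
/- Let 𝒯' be a finite set of tasks, 𝒩 ⊆ 𝒯' × 𝒯' negator relationships, A ∈ 𝒯', and let 𝒯 = 𝒯' ∪ {X, Y, Z} with new tasks X, Y, Z ∉ 𝒯' and 𝒩' = 𝒩 ∪ {(A, X), (A, Y), (A, Z), (X, Z), (Z, Y), (Y, X)}. If V' ⊆ 𝒯' is a stable task assignment for (𝒯', 𝒩) with A ∈ V', then V' (viewed as a subset of 𝒯) is also a stable task assignment for (𝒯, 𝒩'): the assigned task A blocks X, Y and Z via its negator relationships, and no negator relationship of 𝒩' is violated. -/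
/-- A stable task assignment of the original instance that contains `A` is also a
stable task assignment of the extended NEGATOR-STABILITY instance: the assigned
task `A` blocks `X`, `Y` and `Z` via its negator relationships. -/
theorem stable_of_stable_with_A {α : Type*} [DecidableEq α] (𝒯' : Finset α)
    (𝒩 : Finset (α × α)) (h𝒩 : 𝒩 ⊆ 𝒯' ×ˢ 𝒯') (A : α) (hA : A ∈ 𝒯')
    (X Y Z : α) (hX : X ∉ 𝒯') (hY : Y ∉ 𝒯') (hZ : Z ∉ 𝒯')
    (hXY : X ≠ Y) (hXZ : X ≠ Z) (hYZ : Y ≠ Z) (V' : Finset α)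
    (hV' : IsStable 𝒯' 𝒩 V') (hAV : A ∈ V') :
    IsStable (𝒯' ∪ {X, Y, Z})
      (𝒩 ∪ {(A, X), (A, Y), (A, Z), (X, Z), (Z, Y), (Y, X)}) V' := by
  obtain ⟨h1, h2, h3⟩ := hV'
  refine ⟨fun t ht => Finset.mem_union_left _ (h1 ht), ?_, ?_⟩
  · intro t ht htV
    rcases Finset.mem_union.1 ht with h | h
    · obtain ⟨t', ht', hn⟩ := h2 t h htV
      exact ⟨t', ht', Finset.mem_union_left _ hn⟩
    · refine ⟨A, hAV, Finset.mem_union_right _ ?_⟩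
      simp only [Finset.mem_insert, Finset.mem_singleton] at h
      rcases h with rfl | rfl | rfl <;> simp
  · intro t ht t' ht' h
    rcases Finset.mem_union.1 h with h | h
    · exact h3 t ht t' ht' h
    · have := h1 ht
      simp only [Finset.mem_insert, Finset.mem_singleton, Prod.mk.injEq] at h
      rcases h with ⟨_, rfl⟩ | ⟨_, rfl⟩ | ⟨_, rfl⟩ | ⟨_, rfl⟩ | ⟨_, rfl⟩ | ⟨_, rfl⟩ <;> contradiction
end

section
/- Let 𝒯' be a finite set of tasks, 𝒩 ⊆ 𝒯' × 𝒯' negator relationships, 𝒞 ⊆ 𝒯' × 𝒯' communication relationships, and A ∈ 𝒯'. Form the extended instance by adding two new tasks X, Y ∉ 𝒯', with task set 𝒯 = 𝒯' ∪ {X, Y}, the same negator relationships 𝒩, and communication relationships 𝒞' = 𝒞 ∪ {(X, A), (A, Y)}. Then there exists a stable task assignment V ⊆ 𝒯 for (𝒯, 𝒩) together with a path from X to Y using only edges of 𝒞' whose endpoints and intermediate tasks all lie in V, if and only if there exists a stable task assignment V' ⊆ 𝒯' for (𝒯', 𝒩) with A ∈ V'. (This is the correctness of the polynomial-time reduction from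 NEGATOR-SAT to NEGATOR-PATH.) -/
/-- A communication path from `A` to `B` inside `V`: a finite nonempty sequence of
tasks starting at `A` and ending at `B`, all contained in `V`, with each consecutive
pair an edge of `𝒞`. -/
def IsCommPath {α : Type*} (𝒞 : Finset (α × α)) (V : Finset α) (A B : α)
    (p : List α) : Prop :=
  p.head? = some A ∧ p.getLast? = some B ∧
    List.Chain' (fun s t => (s, t) ∈ 𝒞) p ∧ ∀ x ∈ p, x ∈ V

/-- Correctness of the reduction from NEGATOR-SAT to NEGATOR-PATH: with two fresh
tasks `X, Y` and the communication edges `(X, A)` and `(A, Y)` added, there is a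
stable task assignment together with a communication path from `X` to `Y` iff the
original instance has a stable task assignment containing `A`. -/
theorem negSat_to_negPath {α : Type*} [DecidableEq α] (𝒯' : Finset α)
    (𝒩 : Finset (α × α)) (h𝒩 : 𝒩 ⊆ 𝒯' ×ˢ 𝒯')
    (𝒞 : Finset (α × α)) (h𝒞 : 𝒞 ⊆ 𝒯' ×ˢ 𝒯') (A : α) (hA : A ∈ 𝒯')
    (X Y : α) (hX : X ∉ 𝒯') (hY : Y ∉ 𝒯') (hXY : X ≠ Y) :
    (∃ (V : Finset α) (p : List α), IsStable (𝒯' ∪ {X, Y}) 𝒩 V ∧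
        IsCommPath (𝒞 ∪ {(X, A), (A, Y)}) V X Y p) ↔
    (∃ V' : Finset α, IsStable 𝒯' 𝒩 V' ∧ A ∈ V') := by
  have hN : ∀ a b, (a, b) ∈ 𝒩 → a ∈ 𝒯' ∧ b ∈ 𝒯' := fun a b h => by
    simpa using h𝒩 h
  have hC : ∀ a b, (a, b) ∈ 𝒞 → a ∈ 𝒯' ∧ b ∈ 𝒯' := fun a b h => by
    simpa using h𝒞 h
  have hXA : X ≠ A := fun h => hX (h ▸ hA)
  constructor
  · rintro ⟨V, p, ⟨h1, h2, h3⟩, hh, hl, hc, hm⟩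
    have hAV : A ∈ V := by
      match p, hh, hl, hc, hm with
      | [], hh, _, _, _ => simp at hh
      | [a], hh, hl, _, _ =>
        simp at hh hl
        exact absurd (hh.symm.trans hl) hXY
      | a :: b :: q, hh, _, hc, hm =>
        simp only [List.head?_cons, Option.some.injEq] at hh
        subst hh
        have he := (List.isChain_cons_cons.1 hc).1
        simp only [Finset.mem_union, Finset.mem_insert, Finset.mem_singleton,
          Prod.mk.injEq] at he
        have hb : b = A := by
          rcases he with he | he | he
          · exact absurd (hC _ _ he).1 hX
          · exact he.2
          · exact absurd he.1 hXA
        exact hb ▸ hm b (by simp)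
    refine ⟨V ∩ 𝒯', ⟨Finset.inter_subset_right, ?_, ?_⟩, Finset.mem_inter.2 ⟨hAV, hA⟩⟩
    · intro t ht htV
      obtain ⟨t', ht', hn⟩ := h2 t (Finset.mem_union_left _ ht)
        (fun h => htV (Finset.mem_inter.2 ⟨h, ht⟩))
      exact ⟨t', Finset.mem_inter.2 ⟨ht', (hN _ _ hn).1⟩, hn⟩
    · intro t ht t' ht'
      exact h3 t (Finset.mem_inter.1 ht).1 t' (Finset.mem_inter.1 ht').1
  · rintro ⟨V, ⟨h1, h2, h3⟩, hAV⟩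
    refine ⟨V ∪ {X, Y}, [X, A, Y], ⟨Finset.union_subset_union_left h1, ?_, ?_⟩,
      rfl, rfl, ?_, ?_⟩
    · intro t ht htV
      simp only [Finset.mem_union, not_or] at ht htV
      obtain ⟨t', ht', hn⟩ := h2 t (ht.resolve_right htV.2) htV.1
      exact ⟨t', Finset.mem_union_left _ ht', hn⟩
    · have key : ∀ t ∈ V ∪ {X, Y}, t ∈ 𝒯' → t ∈ V := by
        intro t ht htT
        simp only [Finset.mem_union, Finset.mem_insert, Finset.mem_singleton] at ht
        rcases ht with h | h | h
        · exact h
        · exact absurd (h ▸ htT) hX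
        · exact absurd (h ▸ htT) hY
      intro t ht t' ht' hn
      exact h3 t (key t ht (hN _ _ hn).2) t' (key t' ht' (hN _ _ hn).1) hn
    · refine List.isChain_cons_cons.2 ⟨by simp, List.isChain_cons_cons.2 ⟨by simp, ?_⟩⟩
      exact List.isChain_singleton _
    · intro x hx
      simp only [List.mem_cons, List.not_mem_nil, or_false] at hx
      rcases hx with rfl | rfl | rfl <;> simp [hAV]
end
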